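/- arXiv:2211.14076 — 2 statements merged into one kernel-verified Lean document; each statement's English description precedes it below -/
import Mathlib

section
/- Let L ⊆ A* be a factorial language and σ: A* → B* a substitution whose incidence matrix M_σ = (|σ(a)|_b)_{b∈B, a∈A} is invertible. If F(σ(L)) is letter-balanced, then L is letter-balanced. -/
open List

/-- Number of occurrences of `v` as a factor of `w`, i.e. the number of
decompositions `w = p ++ v ++ s`. -/
def occ {A : Type*} [DecidableEq A] (v w : List A) : ℕ :=
  (List.range (w.length + 1)).countP (fun i => decide (v <+: w.drop i))

/-- Apply a substitution (given by its values on letters) to a word. -/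
def applyS {A B : Type*} (σ : A → List B) (w : List A) : List B :=
  (w.map σ).flatten

/-- Occurrences of a one-letter word are counted by `List.count`. -/
theorem occ_singleton {A : Type*} [DecidableEq A] (a : A) (w : List A) :
    occ [a] w = w.count a := by
  induction w with
  | nil => simp [occ]
  | cons x t ih =>
    have h : occ [a] (x :: t) = occ [a] t + if a = x then 1 else 0 := by
      simp only [occ, List.length_cons]
      rw [List.range_succ_eq_map, List.countP_cons, List.countP_map]
      simp [Function.comp_def, List.cons_prefix_cons]
    rw [h, ih, List.count_cons]
    simp [@eq_comm _ x a]

theorem applyS_cons {A B : Type*} (σ : A → List B) (a : A) (w : List A) :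
    applyS σ (a :: w) = σ a ++ applyS σ w := by
  simp [applyS]

theorem applyS_append {A B : Type*} (σ : A → List B) (v w : List A) :
    applyS σ (v ++ w) = applyS σ v ++ applyS σ w := by
  simp [applyS]

/-- The abelianization of `σ(w)` is the incidence matrix applied to that of `w`. -/
theorem count_applyS {A B : Type*} [Fintype A] [DecidableEq A] [DecidableEq B]
    (σ : A → List B) (b : B) (w : List A) :
    (applyS σ w).count b = ∑ a, (σ a).count b * w.count a := by
  induction w with
  | nil => simp [applyS]
  | cons x t ih =>
    simp [applyS_cons, ih, List.count_cons, mul_add, Finset.sum_add_distrib]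
    exact Nat.add_comm _ _

theorem length_eq_sum_count {A : Type*} [Fintype A] [DecidableEq A] (w : List A) :
    w.length = ∑ a, w.count a := by
  induction w with
  | nil => simp
  | cons x t ih => simp [List.count_cons, Finset.sum_add_distrib, ih]

/-- Any length up to `|σ(w)|` is approximated from below, up to the maximal length of the
image of a letter, by the length of the image of a prefix of `w`. -/
theorem exists_prefix_length_applyS {A B : Type*} (σ : A → List B) (K : ℕ)
    (hK : ∀ a, (σ a).length ≤ K) (w : List A) (m : ℕ) (hm : m ≤ (applyS σ w).length) :
    ∃ v, v <+: w ∧ (applyS σ v).length ≤ m ∧ m ≤ (applyS σ v).length + K := by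
  induction w generalizing m with
  | nil => exact ⟨[], List.prefix_rfl, by simp [applyS], by simp_all [applyS]⟩
  | cons a t ih =>
    rcases lt_or_ge m (σ a).length with h | h
    · exact ⟨[], List.nil_prefix, by simp [applyS], by have := hK a; omega⟩
    · rw [applyS_cons, List.length_append] at hm
      obtain ⟨v, hv, h1, h2⟩ := ih (m - (σ a).length) (by omega)
      refine ⟨a :: v, by simpa [List.cons_prefix_cons] using hv, ?_, ?_⟩ <;>
        rw [applyS_cons, List.length_append] <;> omega

/-- A left inverse of the incidence matrix bounds the difference of the abelianizations of
two words in terms of that of their images. -/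
theorem abs_count_sub_le {A B : Type*} [Fintype A] [DecidableEq A] [Fintype B] [DecidableEq B]
    (σ : A → List B) (N : Matrix A B ℚ)
    (hN : N * (Matrix.of fun (b : B) (a : A) => ((σ a).count b : ℚ)) = 1)
    (E : ℚ) (w v : List A)
    (hE : ∀ b, |((applyS σ w).count b : ℚ) - ((applyS σ v).count b : ℚ)| ≤ E) (a : A) :
    |(w.count a : ℚ) - (v.count a : ℚ)| ≤ (∑ b, |N a b|) * E := by
  have key (u : List A) : ∑ b, N a b * ((applyS σ u).count b : ℚ) = (u.count a : ℚ) := by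
    have h : (fun b => ((applyS σ u).count b : ℚ)) =
        (Matrix.of fun (b : B) (a : A) => ((σ a).count b : ℚ)).mulVec
          (fun a => (u.count a : ℚ)) := by
      ext b
      simp [count_applyS, Matrix.mulVec, dotProduct]
    have h2 := congrFun (congrArg N.mulVec h) a
    rw [Matrix.mulVec_mulVec, hN, Matrix.one_mulVec] at h2
    exact h2
  rw [← key w, ← key v, ← Finset.sum_sub_distrib, Finset.sum_mul]
  refine (Finset.abs_sum_le_sum_abs _ _).trans (Finset.sum_le_sum fun b _ => ?_)
  rw [← mul_sub, abs_mul]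
  exact mul_le_mul_of_nonneg_left (hE b) (abs_nonneg _)

/-- if `σ` is a substitution whose incidence matrix
`M_σ = (|σ(a)|_b)_{b ∈ B, a ∈ A}` is invertible and the set of factors of `σ(L)` of
a factorial language `L` is letter-balanced, then `L` is letter-balanced. -/
theorem letter_balanced_of_image {A B : Type*} [Fintype A] [DecidableEq A]
    [Fintype B] [DecidableEq B]
    (L : Set (List A)) (σ : A → List B)
    (hfac : ∀ w ∈ L, ∀ v : List A, v <:+: w → v ∈ L)
    (hM : ∃ N : Matrix A B ℚ,
      (Matrix.of fun (b : B) (a : A) => ((σ a).count b : ℚ)) * N = 1 ∧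
      N * (Matrix.of fun (b : B) (a : A) => ((σ a).count b : ℚ)) = 1)
    (hbal : ∃ C : ℕ, ∀ b : B,
      ∀ w ∈ {w : List B | ∃ y ∈ L, w <:+: applyS σ y},
        ∀ w' ∈ {w : List B | ∃ y ∈ L, w <:+: applyS σ y},
        w.length = w'.length → |(occ [b] w : ℤ) - (occ [b] w' : ℤ)| ≤ (C : ℤ)) :
    ∃ C : ℕ, ∀ a : A, ∀ w ∈ L, ∀ w' ∈ L, w.length = w'.length →
      |(occ [a] w : ℤ) - (occ [a] w' : ℤ)| ≤ (C : ℤ) := by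
  obtain ⟨N, -, hN⟩ := hM
  obtain ⟨C, hC⟩ := hbal
  simp only [occ_singleton] at hC ⊢
  obtain ⟨K, hK⟩ : ∃ K : ℕ, ∀ a, (σ a).length ≤ K :=
    ⟨∑ a, (σ a).length, fun a =>
      Finset.single_le_sum (f := fun a => (σ a).length) (fun _ _ => Nat.zero_le _)
        (Finset.mem_univ a)⟩
  set E : ℚ := C + K with hE
  have hE0 : 0 ≤ E := by positivity
  set S : ℚ := ∑ a, ∑ b, |N a b| with hS
  have main (a : A) (w : List A) (hw : w ∈ L) (w' : List A) (hw' : w' ∈ L)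
      (hlen : w.length = w'.length) (hle : (applyS σ w).length ≤ (applyS σ w').length) :
      |(w.count a : ℚ) - (w'.count a : ℚ)| ≤ S * E + S * E := by
    obtain ⟨v, ⟨s, rfl⟩, h1, h2⟩ := exists_prefix_length_applyS σ K hK w' _ hle
    have hbound (b : B) :
        |((applyS σ w).count b : ℚ) - ((applyS σ v).count b : ℚ)| ≤ E := by
      set r := (applyS σ s).take ((applyS σ w).length - (applyS σ v).length) with hr
      have hrl : r.length = (applyS σ w).length - (applyS σ v).length := by
        rw [applyS_append, List.length_append] at hle
        rw [hr, List.length_take]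
        omega
      have hp := hC b (applyS σ w) ⟨w, hw, List.infix_rfl⟩ (applyS σ v ++ r)
        ⟨v ++ s, hw', by
          rw [applyS_append]
          exact ((List.prefix_append_right_inj _).2 (List.take_prefix _ _)).isInfix⟩
        (by rw [List.length_append, hrl]; omega)
      have hc : r.count b ≤ K := List.count_le_length.trans (by omega)
      rw [List.count_append] at hp
      have hz : |((applyS σ w).count b : ℤ) - ((applyS σ v).count b : ℤ)| ≤ C + K := by
        rw [abs_le] at hp ⊢
        push_cast at hp
        omega
      rw [hE]
      exact_mod_cast hz
    have hcount := abs_count_sub_le σ N hN E w v hbound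
    have hwv : |(w.count a : ℚ) - (v.count a : ℚ)| ≤ S * E :=
      (hcount a).trans (mul_le_mul_of_nonneg_right
        (Finset.single_le_sum (f := fun a => ∑ b, |N a b|)
          (fun _ _ => Finset.sum_nonneg fun _ _ => abs_nonneg _) (Finset.mem_univ a)) hE0)
    have hs : (s.length : ℚ) ≤ S * E := by
      have h : (s.length : ℚ) = ∑ a, ((w.count a : ℚ) - (v.count a : ℚ)) := by
        rw [List.length_append] at hlen
        have hw := length_eq_sum_count w
        have hv := length_eq_sum_count v
        rw [Finset.sum_sub_distrib, ← Nat.cast_sum, ← Nat.cast_sum, ← hw, ← hv, hlen]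
        push_cast
        ring
      rw [h, hS, Finset.sum_mul]
      exact Finset.sum_le_sum fun a _ => (le_abs_self _).trans (hcount a)
    have hsa : (s.count a : ℚ) ≤ s.length := by exact_mod_cast List.count_le_length
    have hs0 : (0 : ℚ) ≤ s.count a := by positivity
    rw [List.count_append]
    push_cast
    rw [abs_le] at hwv ⊢
    constructor <;> linarith
  refine ⟨⌈S * E + S * E⌉₊, fun a w hw w' hw' hlen => ?_⟩
  have h : |(w.count a : ℚ) - (w'.count a : ℚ)| ≤ (⌈S * E + S * E⌉₊ : ℚ) := by
    refine le_trans ?_ (Nat.le_ceil _)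
    rcases le_total (applyS σ w).length (applyS σ w').length with hle | hle
    · exact main a w hw w' hw' hlen hle
    · rw [abs_sub_comm]
      exact main a w' hw' w hw hlen.symm hle
  exact_mod_cast h
end

section
/- Let σ = (σ_k)_{k≥0} be an everywhere growing sequence of substitutions σ_k: A_{k+1}* → A_k* such that the level-k language L_σ^(k) is balanced for length 2 for infinitely many k. Then L_σ is factor-balanced. -/
open List

/-- A substitution is left proper if all images of letters start with the same
letter (in particular they are nonempty). -/
def LeftProper {A B : Type*} (σ : A → List B) : Prop :=
  ∃ b : B, ∀ a : A, ∃ t : List B, σ a = b :: t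

/-- A substitution is right proper if all images of letters end with the same
letter (in particular they are nonempty). -/
def RightProper {A B : Type*} (σ : A → List B) : Prop :=
  ∃ b : B, ∀ a : A, ∃ t : List B, σ a = t ++ [b]

/-- For a sequence of substitutions `σₖ : A_{k+1}* → A_k*`, the composition
`σ_{[k,k+m)} = σ_k ∘ σ_{k+1} ∘ ⋯ ∘ σ_{k+m-1} : A_{k+m}* → A_k*`, on letters. -/
def seg {A : ℕ → Type*} (σ : ∀ k, A (k + 1) → List (A k)) (k : ℕ) :
    (m : ℕ) → A (k + m) → List (A k)
  | 0, a => [a]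
  | m + 1, a => applyS (seg σ k m) (σ (k + m) a)

/-- The language of the sequence `σ` at level `k`: words over `A_k` that are factors
of `σ_{[k,n)}(a)` for some letter `a ∈ A_n`, for infinitely many `n > k`
(written with `n = k + m`, `m > 0`). -/
def LangAt {A : ℕ → Type*}
    (σ : ∀ k, A (k + 1) → List (A k)) (k : ℕ) : Set (List (A k)) :=
  {w | {m : ℕ | 0 < m ∧ ∃ a : A (k + m), w <:+: seg σ k m a}.Infinite}

section Occurrences

variable {A : Type*} [DecidableEq A]

theorem occ_cons (v : List A) (a : A) (w : List A) :
    occ v (a :: w) = (if v <+: a :: w then 1 else 0) + occ v w := by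
  unfold occ
  rw [List.length_cons, List.range_succ_eq_map, List.countP_cons, List.countP_map, add_comm]
  simp [Function.comp_def]

theorem occ_nil {v : List A} (hv : v ≠ []) : occ v [] = 0 := by
  simp [occ, hv]

theorem occ_le_length {v : List A} (hv : v ≠ []) (w : List A) : occ v w ≤ w.length := by
  induction w with
  | nil => simp [occ_nil hv]
  | cons a w ih =>
    rw [occ_cons, List.length_cons]
    split_ifs <;> omega

theorem occ_le_occ_append_left (v x y : List A) : occ v y ≤ occ v (x ++ y) := by
  induction x with
  | nil => simp
  | cons a x ih =>
    rw [List.cons_append, occ_cons]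
    omega

theorem occ_append_left_le (v x y : List A) : occ v (x ++ y) ≤ x.length + occ v y := by
  induction x with
  | nil => simp
  | cons a x ih =>
    rw [List.cons_append, occ_cons, List.length_cons]
    split_ifs <;> omega

theorem occ_le_occ_append_right {v : List A} (hv : v ≠ []) (x y : List A) :
    occ v x ≤ occ v (x ++ y) := by
  induction x with
  | nil => simp [occ_nil hv]
  | cons a x ih =>
    rw [List.cons_append, occ_cons, occ_cons]
    by_cases h : v <+: a :: x
    · have h' : v <+: a :: (x ++ y) := h.trans (List.prefix_append (a :: x) y)
      rw [if_pos h, if_pos h']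
      omega
    · rw [if_neg h]
      omega

theorem occ_append_right_le {v : List A} (hv : v ≠ []) (x y : List A) :
    occ v (x ++ y) ≤ occ v x + v.length + y.length := by
  induction x with
  | nil =>
    have := occ_le_length hv y
    simp only [List.nil_append]
    omega
  | cons a x ih =>
    by_cases hl : v.length ≤ (a :: x).length
    · have h : v <+: a :: (x ++ y) ↔ v <+: a :: x :=
        ⟨fun h => List.prefix_of_prefix_length_le h (List.prefix_append (a :: x) y) hl,
          fun h => h.trans (List.prefix_append (a :: x) y)⟩
      rw [List.cons_append, occ_cons, occ_cons, if_congr h rfl rfl]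
      omega
    · have := occ_le_length hv (a :: x ++ y)
      rw [List.length_append] at this
      omega

/-- Occurrences of `v` starting in `x` inside `x ++ y ++ z` only see `x ++ y` when `y` is at least
as long as `v`. -/
theorem occ_append_append (v x y z : List A) (h : v.length ≤ y.length) :
    occ v (x ++ (y ++ z)) + occ v y = occ v (x ++ y) + occ v (y ++ z) := by
  induction x with
  | nil => simp [add_comm]
  | cons a x ih =>
    have hp : v <+: a :: (x ++ (y ++ z)) ↔ v <+: a :: (x ++ y) := by
      have e : a :: (x ++ y) <+: a :: (x ++ (y ++ z)) := ⟨z, by simp⟩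
      refine ⟨fun h' => List.prefix_of_prefix_length_le h' e ?_, fun h' => h'.trans e⟩
      simp only [List.length_cons, List.length_append]
      omega
    rw [List.cons_append, List.cons_append, occ_cons, occ_cons, if_congr hp rfl rfl]
    omega

theorem abs_occ_append_append_sub_le {v : List A} (hv : v ≠ []) (s w p : List A) :
    |(occ v (s ++ w ++ p) : ℤ) - occ v w| ≤ s.length + v.length + p.length := by
  have h₁ := occ_le_occ_append_right hv (s ++ w) p
  have h₂ := occ_append_right_le hv (s ++ w) p
  have h₃ := occ_le_occ_append_left v s w
  have h₄ := occ_append_left_le v s w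
  rw [abs_le]
  omega

end Occurrences

section PairSum

variable {B : Type*}

/-- The sum of `f a b` over all pairs of consecutive letters `a b` of a word. -/
def pairSum (f : B → B → ℤ) : List B → ℤ
  | a :: b :: r => f a b + pairSum f (b :: r)
  | _ => 0

theorem pairSum_eq_sum_occ [Fintype B] [DecidableEq B] (f : B → B → ℤ) (u : List B) :
    pairSum f u = ∑ a, ∑ b, (occ [a, b] u : ℤ) * f a b := by
  induction u with
  | nil => simp [pairSum, occ_nil]
  | cons c u ih =>
    cases u with
    | nil => simp [pairSum, occ_cons, occ_nil]
    | cons d r =>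
      have key : ∀ a b : B, (occ [a, b] (c :: d :: r) : ℤ) * f a b =
          (if a = c then if b = d then f a b else 0 else 0) +
            (occ [a, b] (d :: r) : ℤ) * f a b := by
        intro a b
        rw [occ_cons [a, b] c]
        by_cases h₁ : a = c <;> by_cases h₂ : b = d <;> (simp [h₁, h₂]; try ring)
      simp only [key, Finset.sum_add_distrib, pairSum, ih]
      congr 1
      rw [Finset.sum_eq_single c (by simp +contextual) (by simp)]
      simp

theorem abs_pairSum_sub_le [Fintype B] [DecidableEq B] {f : B → B → ℤ} {M C : ℕ}
    (hf : ∀ a b, |f a b| ≤ M) {u u' : List B}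
    (hC : ∀ a b, |(occ [a, b] u : ℤ) - occ [a, b] u'| ≤ C) :
    |pairSum f u - pairSum f u'| ≤ Fintype.card B * (Fintype.card B * (C * M)) := by
  rw [pairSum_eq_sum_occ, pairSum_eq_sum_occ, ← Finset.sum_sub_distrib]
  have h : ∀ a b : B, |(occ [a, b] u : ℤ) * f a b - occ [a, b] u' * f a b| ≤ C * M := by
    intro a b
    rw [← sub_mul, abs_mul]
    exact mul_le_mul (hC a b) (hf a b) (abs_nonneg _) (by positivity)
  calc _ ≤ ∑ _a : B, ∑ _b : B, (C * M : ℤ) := by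
        refine (Finset.abs_sum_le_sum_abs _ _).trans (Finset.sum_le_sum fun a _ => ?_)
        rw [← Finset.sum_sub_distrib]
        exact (Finset.abs_sum_le_sum_abs _ _).trans (Finset.sum_le_sum fun b _ => h a b)
    _ = _ := by simp

end PairSum

section Substitution

variable {A B : Type*}

@[simp]
theorem applyS_nil (τ : B → List A) : applyS τ [] = [] := rfl

@[simp]
theorem applyS_cons_s13 (τ : B → List A) (b : B) (u : List B) :
    applyS τ (b :: u) = τ b ++ applyS τ u := rfl

theorem applyS_append_s13 (τ : B → List A) (u u' : List B) :
    applyS τ (u ++ u') = applyS τ u ++ applyS τ u' := by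
  simp [applyS]

theorem applyS_applyS {D : Type*} (τ : B → List A) (ρ : D → List B) (u : List D) :
    applyS τ (applyS ρ u) = applyS (fun d => applyS τ (ρ d)) u := by
  induction u with
  | nil => rfl
  | cons d u ih => rw [applyS_cons_s13, applyS_append_s13, ih, applyS_cons_s13]

theorem length_le_length_applyS {τ : B → List A} (h : ∀ b, 1 ≤ (τ b).length) (u : List B) :
    u.length ≤ (applyS τ u).length := by
  induction u with
  | nil => simp
  | cons b u ih =>
    have := h b
    simp only [applyS_cons_s13, List.length_cons, List.length_append]
    omega

theorem exists_of_prefix_applyS {τ : B → List A} {M : ℕ} (hM : ∀ b, (τ b).length ≤ M)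
    (u : List B) (w : List A) (h : w <+: applyS τ u) :
    ∃ u' p, u' <+: u ∧ w = applyS τ u' ++ p ∧ p.length ≤ M := by
  induction u generalizing w with
  | nil => exact ⟨[], [], by simp, by simpa using h, by simp⟩
  | cons b u ih =>
    obtain ⟨y, hy⟩ := h
    rw [applyS_cons_s13, List.append_eq_append_iff] at hy
    rcases hy with ⟨x, hx, -⟩ | ⟨x, hx, hx'⟩
    · refine ⟨[], w, by simp, by simp, le_trans ?_ (hM b)⟩
      simp [hx]
    · obtain ⟨u', p, hu, rfl, hp⟩ := ih x ⟨y, hx'.symm⟩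
      exact ⟨b :: u', p, by simpa using hu, by simp [hx], hp⟩

/-- A factor of the image of `u` is, up to two short words at its ends, the image of a factor
of `u`. -/
theorem exists_of_infix_applyS {τ : B → List A} {M : ℕ} (hM : ∀ b, (τ b).length ≤ M)
    (u : List B) (w : List A) (h : w <:+: applyS τ u) :
    ∃ u' s p, u' <:+: u ∧ w = s ++ applyS τ u' ++ p ∧ s.length ≤ M ∧ p.length ≤ M := by
  induction u with
  | nil => exact ⟨[], [], [], by simp, by simpa using h, by simp, by simp⟩
  | cons b u ih =>
    obtain ⟨x, y, hxy⟩ := h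
    rw [applyS_cons_s13, List.append_assoc, List.append_eq_append_iff] at hxy
    rcases hxy with ⟨t, ht, ht'⟩ | ⟨t, ht, ht'⟩
    · have htM : t.length ≤ M := by
        have := hM b
        rw [ht, List.length_append] at this
        omega
      rw [List.append_eq_append_iff] at ht'
      rcases ht' with ⟨s, hs, hs'⟩ | ⟨s, hs, hs'⟩
      · refine ⟨[], w, [], by simp, by simp, ?_, by simp⟩
        rw [hs, List.length_append] at htM
        omega
      · obtain ⟨u', p, hu, rfl, hp⟩ := exists_of_prefix_applyS hM u s ⟨y, hs'.symm⟩
        exact ⟨u', t, p, hu.isInfix.trans (List.suffix_cons b u).isInfix, by simp [hs], htM, hp⟩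
    · obtain ⟨u', s, p, hu, hw, hs, hp⟩ := ih ⟨t, y, by rw [ht', List.append_assoc]⟩
      exact ⟨u', s, p, hu.trans (List.suffix_cons b u).isInfix, hw, hs, hp⟩

theorem abs_length_applyS_sub_pairSum_le {τ : B → List A} {M : ℕ}
    (hM : ∀ b, (τ b).length ≤ M) (u : List B) :
    |((applyS τ u).length : ℤ) - pairSum (fun a _ => ((τ a).length : ℤ)) u| ≤ M := by
  induction u with
  | nil => simp [pairSum]
  | cons a u ih =>
    cases u with
    | nil => simpa [pairSum] using hM a
    | cons b r =>
      rw [applyS_cons_s13, pairSum, List.length_append]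
      push_cast
      rwa [add_sub_add_left_eq_sub]

theorem abs_occ_applyS_sub_pairSum_le [DecidableEq A] {τ : B → List A} {M : ℕ} {v : List A}
    (hv : v ≠ []) (hM : ∀ b, (τ b).length ≤ M) (hτ : ∀ b, v.length ≤ (τ b).length)
    (u : List B) :
    |(occ v (applyS τ u) : ℤ) -
      pairSum (fun a b => (occ v (τ a ++ τ b) : ℤ) - occ v (τ b)) u| ≤ M := by
  induction u with
  | nil => simp [pairSum, occ_nil hv]
  | cons a u ih =>
    cases u with
    | nil => simpa [pairSum] using (occ_le_length hv (τ a)).trans (hM a)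
    | cons b r =>
      have h := occ_append_append v (τ a) (τ b) (applyS τ r) (hτ b)
      rw [applyS_cons_s13] at ih
      rw [applyS_cons_s13, applyS_cons_s13, pairSum]
      rw [abs_le] at ih ⊢
      omega

/-- If a set of words is closed under prefixes and balanced for length `2`, then images of its
elements with close lengths have close numbers of occurrences of any short enough word. -/
theorem abs_occ_applyS_sub_le [DecidableEq A] [Fintype B] [DecidableEq B] {τ : B → List A}
    {M C : ℕ} {v : List A} (hv : v ≠ []) (hM : ∀ b, (τ b).length ≤ M)
    (hτ : ∀ b, v.length ≤ (τ b).length) {L : Set (List B)}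
    (hL : ∀ u ∈ L, ∀ u', u' <+: u → u' ∈ L)
    (hC : ∀ x : List B, x.length = 2 → ∀ u ∈ L, ∀ u' ∈ L, u.length = u'.length →
      |(occ x u : ℤ) - occ x u'| ≤ C)
    {D : ℕ} {u u' : List B} (hu : u ∈ L) (hu' : u' ∈ L)
    (hD : |((applyS τ u).length : ℤ) - (applyS τ u').length| ≤ D) :
    |(occ v (applyS τ u) : ℤ) - occ v (applyS τ u')| ≤
      2 * (2 * M + Fintype.card B * (Fintype.card B * (C * M))) + D + v.length := by
  wlog hle : u.length ≤ u'.length generalizing u u'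
  · rw [abs_sub_comm]
    exact this hu' hu (by rwa [abs_sub_comm]) (by omega)
  obtain ⟨y, r, rfl, hy⟩ : ∃ y r, u' = y ++ r ∧ u.length = y.length :=
    ⟨u'.take u.length, u'.drop u.length, by simp, by simp [hle]⟩
  have hyL : y ∈ L := hL _ hu' _ (List.prefix_append y r)
  have hpair : ∀ a b, |(occ [a, b] u : ℤ) - occ [a, b] y| ≤ C :=
    fun a b => hC [a, b] rfl u hu y hyL hy
  have hlen := abs_pairSum_sub_le (f := fun a _ => ((τ a).length : ℤ)) (M := M)
    (fun a b => by simpa using hM a) hpair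
  have hocc := abs_pairSum_sub_le
    (f := fun a b => (occ v (τ a ++ τ b) : ℤ) - occ v (τ b)) (M := M) (fun a b => by
      have h₁ := occ_le_occ_append_left v (τ a) (τ b)
      have h₂ := occ_append_left_le v (τ a) (τ b)
      have h₃ := hM a
      rw [abs_le]
      omega) hpair
  have l₁ := abs_length_applyS_sub_pairSum_le hM u
  have l₂ := abs_length_applyS_sub_pairSum_le hM y
  have o₁ := abs_occ_applyS_sub_pairSum_le hv hM hτ u
  have o₂ := abs_occ_applyS_sub_pairSum_le hv hM hτ y
  have e₁ := occ_le_occ_append_right hv (applyS τ y) (applyS τ r)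
  have e₂ := occ_append_right_le hv (applyS τ y) (applyS τ r)
  rw [applyS_append_s13] at hD ⊢
  rw [List.length_append] at hD
  generalize (Fintype.card B : ℤ) * (Fintype.card B * (C * M)) = K at *
  rw [abs_le] at *
  omega

end Substitution

section SAdic

variable {A : ℕ → Type*} (σ : ∀ k, A (k + 1) → List (A k))

theorem mem_LangAt_of_factor {k : ℕ} {u u' : List (A k)} (hu : u ∈ LangAt σ k)
    (h : u' <:+: u) : u' ∈ LangAt σ k := by
  refine Set.Infinite.mono ?_ hu
  rintro m ⟨hm, a, ha⟩
  exact ⟨hm, a, h.trans ha⟩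

/-- The substitution `σ_{[0,k)}`, defined on letters of `A k` rather than `A (0 + k)`. -/
def initSeg (k : ℕ) (a : A k) : List (A 0) :=
  seg σ 0 k (cast (congrArg A (Nat.zero_add k).symm) a)

theorem applyS_seg_zero {j k : ℕ} (h : j + 1 = k + 1) (a : A (k + 1)) (f : A j → List (A 0)) :
    applyS f (σ j (cast (congrArg A h.symm) a)) =
      applyS (fun b => f (cast (congrArg A (Nat.succ.inj h).symm) b)) (σ k a) := by
  obtain rfl : j = k := Nat.succ.inj h
  rfl

theorem initSeg_add (k m : ℕ) (a : A (k + m)) :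
    initSeg σ (k + m) a = applyS (initSeg σ k) (seg σ k m a) := by
  induction m with
  | zero => simp [seg, applyS]
  | succ m ih =>
    have h : initSeg σ (k + m + 1) a = applyS (initSeg σ (k + m)) (σ (k + m) a) :=
      applyS_seg_zero σ (Nat.zero_add (k + m + 1)) a (seg σ 0 (k + m))
    rw [seg, applyS_applyS]
    refine h.trans ?_
    congr 1
    funext b
    exact ih b

theorem exists_mem_LangAt_of_mem_LangAt_zero [∀ k, Fintype (A k)] {k M : ℕ}
    (hM : ∀ b, (initSeg σ k b).length ≤ M) (hpos : ∀ b, 1 ≤ (initSeg σ k b).length)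
    {w : List (A 0)} (hw : w ∈ LangAt σ 0) :
    ∃ u ∈ LangAt σ k, ∃ s p, w = s ++ applyS (initSeg σ k) u ++ p ∧
      s.length ≤ M ∧ p.length ≤ M := by
  by_contra! hcon
  have hfin : (⋃ u ∈ {u : List (A k) | u.length ≤ w.length ∧ u ∉ LangAt σ k},
      {m : ℕ | 0 < m ∧ ∃ a : A (k + m), u <:+: seg σ k m a}).Finite := by
    refine Set.Finite.biUnion ((List.finite_length_le (A k) w.length).subset fun u hu => hu.1) ?_
    exact fun u hu => Set.not_infinite.1 hu.2
  refine hw (((Set.finite_Iic k).union (hfin.image (k + ·))).subset ?_)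
  rintro n ⟨-, a, ha⟩
  by_cases hn : n ≤ k
  · exact Or.inl hn
  obtain ⟨m, rfl⟩ : ∃ m, n = k + m := ⟨n - k, by omega⟩
  refine Or.inr (Set.mem_image_of_mem (k + ·) ?_)
  have hcast : seg σ 0 (k + m) a =
      initSeg σ (k + m) (cast (congrArg A (Nat.zero_add (k + m))) a) := by
    simp [initSeg]
  rw [hcast, initSeg_add] at ha
  obtain ⟨u, s, p, hu, hsp, hs, hp⟩ := exists_of_infix_applyS hM _ _ ha
  simp only [Set.mem_iUnion]
  refine ⟨u, ⟨?_, fun h => ?_⟩, by omega, _, hu⟩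
  · have := length_le_length_applyS hpos u
    rw [hsp, List.length_append, List.length_append]
    omega
  · have := hcon u h s p hsp hs
    omega

end SAdic

/-- for an everywhere growing sequence of substitutions
(`⟨σ_{[0,k)}⟩ → ∞`), if the level-`k` language is balanced for length `2` for
infinitely many `k`, then `L_σ` is factor-balanced. -/
theorem factor_balanced_of_growing_sadic {A : ℕ → Type*}
    [∀ k, Fintype (A k)] [∀ k, DecidableEq (A k)]
    (σ : ∀ k, A (k + 1) → List (A k))
    (hgrow : ∀ N : ℕ, ∃ K : ℕ, ∀ m : ℕ, K ≤ m → ∀ a : A (0 + m),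
      N ≤ (seg σ 0 m a).length)
    (hbal : {k : ℕ | ∃ C : ℕ, ∀ v : List (A k), v.length = 2 →
      ∀ w ∈ LangAt σ k, ∀ w' ∈ LangAt σ k, w.length = w'.length →
        |(occ v w : ℤ) - (occ v w' : ℤ)| ≤ (C : ℤ)}.Infinite) :
    ∀ n : ℕ, 1 ≤ n → ∃ C : ℕ, ∀ v : List (A 0), v.length = n →
      ∀ w ∈ LangAt σ 0, ∀ w' ∈ LangAt σ 0, w.length = w'.length →
        |(occ v w : ℤ) - (occ v w' : ℤ)| ≤ (C : ℤ) := by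
  intro n hn
  obtain ⟨K, hK⟩ := hgrow n
  obtain ⟨k, ⟨C, hC⟩, hkK⟩ := hbal.exists_gt K
  have hτ : ∀ b, n ≤ (initSeg σ k b).length := fun b => hK k hkK.le _
  obtain ⟨M, hM⟩ : ∃ M, ∀ b, (initSeg σ k b).length ≤ M :=
    ⟨Finset.univ.sup fun b => (initSeg σ k b).length,
      fun b => Finset.le_sup (f := fun b => (initSeg σ k b).length) (Finset.mem_univ b)⟩
  refine ⟨2 * (2 * M + Fintype.card (A k) * (Fintype.card (A k) * (C * M))) + 8 * M + 3 * n, ?_⟩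
  intro v hv w hw w' hw' hww'
  have hv0 : v ≠ [] := by
    rintro rfl
    simp at hv
    omega
  have hpos : ∀ b, 1 ≤ (initSeg σ k b).length := fun b => hn.trans (hτ b)
  obtain ⟨u, hu, s, p, rfl, hs, hp⟩ := exists_mem_LangAt_of_mem_LangAt_zero σ hM hpos hw
  obtain ⟨u', hu', s', p', rfl, hs', hp'⟩ := exists_mem_LangAt_of_mem_LangAt_zero σ hM hpos hw'
  have h₁ := abs_occ_append_append_sub_le hv0 s (applyS (initSeg σ k) u) p
  have h₂ := abs_occ_append_append_sub_le hv0 s' (applyS (initSeg σ k) u') p'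
  have h₃ := abs_occ_applyS_sub_le (D := 4 * M) hv0 hM (fun b => hv ▸ hτ b)
    (fun u hu u' h => mem_LangAt_of_factor σ hu h.isInfix) hC hu hu' (by
      simp only [List.length_append] at hww'
      rw [abs_le]
      omega)
  push_cast at h₃ ⊢
  generalize (Fintype.card (A k) : ℤ) * (Fintype.card (A k) * (C * M)) = Q at *
  rw [abs_le] at *
  omega
end
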